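/- Let n ≥ 3 and 1 ≤ d < n with d ≥ n/2. There exists a constant C > 0 depending only on n such that the following holds. Let Ω ⊂ ℝⁿ be open, let ψ : Ω → ℝ be a C² convex function with ψ ≥ 0 on Ω and det D²ψ(x) ≥ 1/λ² for all x ∈ Ω (λ > 0), and suppose ψ(x₀) = 0 for some x₀ ∈ Ω with δ := dist(x₀, ∂Ω) > 0. Let L := sup_{x ∈ Ω} |∇ψ(x)|, assumed finite and positive, and let H be a d-dimensional affine subspace of ℝⁿ containing x₀. Then for every ℓ with 0 < ℓ ≤ δ/2: if d > n/2 then sup_{x ∈ B_ℓ(x₀) ∩ H} ψ(x) ≥ min{ δ L, ( ℓ^{2d} / (C λ² L^{2n−2d}) )^{1/(2d−n)} }, and if d = n/2 then sup_{x ∈ B_ℓ(x₀) ∩ H} ψ(x) ≥ δ L · exp( −C λ² Lⁿ / ℓⁿ ). -/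

import Mathlib

open MeasureTheory Set Metric Filter
open scoped RealInnerProductSpace ENNReal

noncomputable section

abbrev E (n : ℕ) := EuclideanSpace ℝ (Fin n)

/-- The determinant of the Hessian matrix `D²ψ(x)`. -/
def hessDet {n : ℕ} (ψ : E n → ℝ) (x : E n) : ℝ :=
  Matrix.det (Matrix.of fun i j : Fin n =>
    iteratedFDeriv ℝ 2 ψ x ![EuclideanSpace.single i 1, EuclideanSpace.single j 1])

theorem one_le_det_one_add {k : Type*} [Fintype k] [DecidableEq k] (T : Matrix k k ℝ)
    (hT : T.PosSemidef) : 1 ≤ (1 + T).det := by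
  have h := Matrix.eval_charpoly T (-1)
  rw [hT.1.charpoly_eq] at h
  have h2 : (Matrix.scalar k (-1:ℝ) - T) = -(1 + T) := by
    ext i j; simp [Matrix.one_apply, Matrix.diagonal_apply]; split_ifs <;> ring
  rw [h2, Matrix.det_neg, Polynomial.eval_prod] at h
  have h3 : ∏ j : k, (Polynomial.X - Polynomial.C ((hT.1.eigenvalues j : ℝ))).eval (-1:ℝ) =
      (-1)^(Fintype.card k) * ∏ j, (1 + hT.1.eigenvalues j) := by
    rw [← Finset.card_univ, ← Finset.prod_const, ← Finset.prod_mul_distrib]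
    refine Finset.prod_congr rfl fun j _ => ?_
    simp; ring
  have h4 : (-1:ℝ)^(Fintype.card k) * ∏ j, (1 + hT.1.eigenvalues j) =
      (-1)^(Fintype.card k) * (1+T).det := by
    rw [← h3]; exact h
  have h5 := mul_left_cancel₀ (pow_ne_zero _ (by norm_num)) h4
  rw [← h5]
  calc (1:ℝ) = ∏ j : k, 1 := by simp
    _ ≤ _ := Finset.prod_le_prod (fun _ _ => zero_le_one) fun j _ => by
      have := hT.eigenvalues_nonneg j; linarith

open scoped MatrixOrder in
theorem det_le_det_add {k : Type*} [Fintype k] [DecidableEq k] (P S : Matrix k k ℝ)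
    (hP : P.PosDef) (hS : S.PosSemidef) : P.det ≤ (P + S).det := by
  obtain ⟨R, hR⟩ := CStarAlgebra.nonneg_iff_eq_star_mul_self.mp hP.posSemidef.nonneg
  rw [Matrix.star_eq_conjTranspose] at hR
  have hdet : 0 < P.det := hP.det_pos
  have hRd : IsUnit R.det := by
    rw [isUnit_iff_ne_zero]
    intro h0
    rw [hR, Matrix.det_mul, h0, mul_zero] at hdet
    exact lt_irrefl _ hdet
  have hRd' : IsUnit R.conjTranspose.det := by
    rw [Matrix.det_conjTranspose]; simpa using hRd
  have hT : (R⁻¹.conjTranspose * S * R⁻¹).PosSemidef := hS.conjTranspose_mul_mul_same _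
  have e : P + S = R.conjTranspose * (1 + R⁻¹.conjTranspose * S * R⁻¹) * R := by
    rw [mul_add, add_mul, mul_one, ← hR, Matrix.conjTranspose_nonsing_inv]
    congr 1
    rw [mul_assoc, mul_assoc, mul_assoc, Matrix.nonsing_inv_mul _ hRd, mul_one, ← mul_assoc,
      Matrix.mul_nonsing_inv _ hRd', one_mul]
  have h1 := one_le_det_one_add _ hT
  have e2 : (P + S).det = P.det * (1 + R⁻¹.conjTranspose * S * R⁻¹).det := by
    rw [e, hR, Matrix.det_mul, Matrix.det_mul, Matrix.det_mul]; ring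
  rw [e2]
  nlinarith

theorem fischer {p q : Type*} [Fintype p] [DecidableEq p] [Fintype q] [DecidableEq q]
    (M : Matrix (p ⊕ q) (p ⊕ q) ℝ) (hM : M.PosDef) :
    M.det ≤ M.toBlocks₁₁.det * M.toBlocks₂₂.det := by
  have hA : M.toBlocks₁₁.PosDef := hM.submatrix Sum.inl_injective
  have hC : M.toBlocks₂₁ = M.toBlocks₁₂.conjTranspose := by
    ext i j
    have := hM.1.apply (Sum.inr i) (Sum.inl j)
    simpa [Matrix.toBlocks₂₁, Matrix.toBlocks₁₂] using this.symm
  have hAd := hA.det_pos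
  let _ : Invertible M.toBlocks₁₁ := Matrix.invertibleOfIsUnitDet _ (isUnit_iff_ne_zero.mpr hAd.ne')
  have hMb : M = Matrix.fromBlocks M.toBlocks₁₁ M.toBlocks₁₂ M.toBlocks₁₂.conjTranspose M.toBlocks₂₂ := by
    rw [← hC, Matrix.fromBlocks_toBlocks]
  have hP : (M.toBlocks₂₂ - M.toBlocks₁₂.conjTranspose * M.toBlocks₁₁⁻¹ * M.toBlocks₁₂).PosSemidef := by
    rw [← Matrix.PosDef.fromBlocks₁₁ _ _ hA, ← hMb]; exact hM.posSemidef
  have hdet : M.det = M.toBlocks₁₁.det *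
      (M.toBlocks₂₂ - M.toBlocks₁₂.conjTranspose * M.toBlocks₁₁⁻¹ * M.toBlocks₁₂).det := by
    conv_lhs => rw [hMb]
    rw [Matrix.det_fromBlocks₁₁, Matrix.invOf_eq_nonsing_inv]
  have hP' := hP.posDef_iff_det_ne_zero.mpr (by
    intro h0
    have := hM.det_pos
    rw [hdet, h0, mul_zero] at this
    exact lt_irrefl _ this)
  have hS : (M.toBlocks₁₂.conjTranspose * M.toBlocks₁₁⁻¹ * M.toBlocks₁₂).PosSemidef :=
    hA.inv.posSemidef.conjTranspose_mul_mul_same _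
  have := det_le_det_add _ _ hP' hS
  rw [sub_add_cancel] at this
  rw [hdet]
  exact mul_le_mul_of_nonneg_left this hAd.le

theorem slice_aux {k : ℕ} (U : Set (E k)) (hU : IsOpen U) (hc : Convex ℝ U) (g : E k → E k)
    (g' : E k → E k →L[ℝ] E k) (hg : ∀ x ∈ U, HasFDerivAt g (g' x) x)
    (hpos : ∀ x ∈ U, ∀ v, v ≠ 0 → 0 < ⟪g' x v, v⟫) (ρ : ℝ) (hρ : 0 ≤ ρ)
    (hb : ∀ x ∈ U, ‖g x‖ ≤ ρ) :
    ∫⁻ x in U, ENNReal.ofReal |(g' x).det| ≤ ENNReal.ofReal (ρ ^ k) * volume (ball (0 : E k) 1) := by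
  have hinj : InjOn g U := by
    intro x hx y hy hxy
    by_contra hne
    set v := y - x with hv
    have hv0 : v ≠ 0 := sub_ne_zero.mpr (Ne.symm hne)
    have hmem : ∀ t ∈ Icc (0:ℝ) 1, x + t • v ∈ U := fun t ht => by
      have := hc.add_smul_sub_mem hx hy ht
      simpa [hv] using this
    have hd : ∀ t ∈ Icc (0:ℝ) 1, HasDerivAt (fun t : ℝ => ⟪g (x + t • v), v⟫)
        (⟪g' (x + t • v) v, v⟫) t := by
      intro t ht
      have h1 : HasDerivAt (fun t : ℝ => x + t • v) v t := by
        simpa using ((hasDerivAt_id t).smul_const v).const_add x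
      have h2 := (hg _ (hmem t ht)).comp_hasDerivAt t h1
      have h3 := h2.inner ℝ (hasDerivAt_const t v)
      simpa using h3
    have hm : StrictMonoOn (fun t : ℝ => ⟪g (x + t • v), v⟫) (Icc 0 1) := by
      apply strictMonoOn_of_deriv_pos (convex_Icc 0 1)
      · exact fun t ht => (hd t ht).continuousAt.continuousWithinAt
      · intro t ht
        have ht' := interior_subset ht
        rw [(hd t ht').deriv]
        exact hpos _ (hmem t ht') v hv0
    have := hm (left_mem_Icc.mpr zero_le_one) (right_mem_Icc.mpr zero_le_one) zero_lt_one
    simp [hv, hxy] at this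
  rw [lintegral_abs_det_fderiv_eq_addHaar_image volume hU.measurableSet
    (fun x hx => (hg x hx).hasFDerivWithinAt) hinj]
  have hsub : g '' U ⊆ closedBall 0 ρ := by
    rintro _ ⟨x, hx, rfl⟩
    simpa using hb x hx
  refine (measure_mono hsub).trans ?_
  rw [Measure.addHaar_closedBall _ _ hρ]
  simp

/-- restriction of a functional along `ι`, as a vector. -/
def restr {n k : ℕ} (ι : E k →L[ℝ] E n) : (E n →L[ℝ] ℝ) →L[ℝ] E k :=
  ∑ i : Fin k, (ContinuousLinearMap.apply ℝ ℝ (ι (EuclideanSpace.single i 1))).smulRight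
    (EuclideanSpace.single i (1:ℝ))

theorem restr_apply {n k : ℕ} (ι : E k →L[ℝ] E n) (f : E n →L[ℝ] ℝ) (i : Fin k) :
    restr ι f i = f (ι (EuclideanSpace.single i 1)) := by
  simp [restr, Finset.sum_apply, Pi.single_apply]

theorem inner_restr {n k : ℕ} (ι : E k →L[ℝ] E n) (f : E n →L[ℝ] ℝ) (v : E k) :
    ⟪restr ι f, v⟫ = f (ι v) := by
  have hv : v = ∑ i, v i • EuclideanSpace.single i (1:ℝ) := by
    have := (EuclideanSpace.basisFun (Fin k) ℝ).sum_repr v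
    simpa using this.symm
  conv_rhs => rw [hv]
  rw [map_sum, map_sum, PiLp.inner_apply]
  refine Finset.sum_congr rfl fun i _ => ?_
  simp [restr_apply]

theorem slice {n k : ℕ} {Ω : Set (E n)} (hΩ : IsOpen Ω) {ψ : E n → ℝ} (hψ : ContDiffOn ℝ 2 ψ Ω)
    (ι : E k →L[ℝ] E n) (hι : Function.Injective ι) (z₀ : E n)
    (hpos : ∀ z ∈ Ω, ∀ v, v ≠ 0 → 0 < fderiv ℝ (fderiv ℝ ψ) z v v)
    (U : Set (E k)) (hU : IsOpen U) (hc : Convex ℝ U) (hUΩ : ∀ x ∈ U, z₀ + ι x ∈ Ω)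
    (ρ : ℝ) (hρ : 0 ≤ ρ) (hb : ∀ x ∈ U, ∀ v, fderiv ℝ ψ (z₀ + ι x) (ι v) ≤ ρ * ‖v‖) :
    ∫⁻ x in U, ENNReal.ofReal (Matrix.det (Matrix.of fun i j : Fin k =>
      fderiv ℝ (fderiv ℝ ψ) (z₀ + ι x) (ι (EuclideanSpace.single i 1))
        (ι (EuclideanSpace.single j 1)))) ≤
      ENNReal.ofReal (ρ ^ k) * volume (ball (0 : E k) 1) := by
  have hD : ∀ z ∈ Ω, HasFDerivAt (fderiv ℝ ψ) (fderiv ℝ (fderiv ℝ ψ) z) z := by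
    intro z hz
    have h1 : ContDiffAt ℝ 2 ψ z := hψ.contDiffAt (hΩ.mem_nhds hz)
    have h2 : ContDiffAt ℝ 1 (fderiv ℝ ψ) z := h1.fderiv_right (by norm_num)
    exact (h2.differentiableAt (by norm_num)).hasFDerivAt
  refine le_trans (lintegral_mono fun x => ENNReal.ofReal_le_ofReal ?_)
    (slice_aux U hU hc (fun x => restr ι (fderiv ℝ ψ (z₀ + ι x)))
    (fun x => (restr ι).comp ((fderiv ℝ (fderiv ℝ ψ) (z₀ + ι x)).comp ι)) ?_ ?_ ρ hρ ?_)
  · refine le_trans (le_of_eq ?_) (le_abs_self _)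
    rw [ContinuousLinearMap.det, ← LinearMap.det_toMatrix (EuclideanSpace.basisFun (Fin k) ℝ).toBasis,
      ← Matrix.det_transpose]
    congr 1
    ext i j
    simp [LinearMap.toMatrix_apply, restr_apply]
  · intro x hx
    have h1 : HasFDerivAt (fun x => z₀ + ι x) ι x := ι.hasFDerivAt.const_add z₀
    exact (restr ι).hasFDerivAt.comp x ((hD _ (hUΩ x hx)).comp x h1)
  · intro x hx v hv
    simp only [ContinuousLinearMap.comp_apply]
    rw [inner_restr]
    exact hpos _ (hUΩ x hx) _ (by simpa using hι.ne hv)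
  · intro x hx
    have h := hb x hx (restr ι (fderiv ℝ ψ (z₀ + ι x)))
    rw [← inner_restr, real_inner_self_eq_norm_sq] at h
    by_contra! hlt
    have : 0 < ‖restr ι (fderiv ℝ ψ (z₀ + ι x))‖ := lt_of_le_of_lt hρ hlt
    nlinarith

theorem hess_hasFDerivAt {n : ℕ} {Ω : Set (E n)} (hΩ : IsOpen Ω) {ψ : E n → ℝ}
    (hψ : ContDiffOn ℝ 2 ψ Ω) (z : E n) (hz : z ∈ Ω) :
    HasFDerivAt (fderiv ℝ ψ) (fderiv ℝ (fderiv ℝ ψ) z) z := by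
  have h1 : ContDiffAt ℝ 2 ψ z := hψ.contDiffAt (hΩ.mem_nhds hz)
  have h2 : ContDiffAt ℝ 1 (fderiv ℝ ψ) z := h1.fderiv_right (by norm_num)
  exact (h2.differentiableAt (by norm_num)).hasFDerivAt

theorem psi_hasFDerivAt {n : ℕ} {Ω : Set (E n)} (hΩ : IsOpen Ω) {ψ : E n → ℝ}
    (hψ : ContDiffOn ℝ 2 ψ Ω) (z : E n) (hz : z ∈ Ω) :
    HasFDerivAt ψ (fderiv ℝ ψ z) z := by
  have h1 : ContDiffAt ℝ 2 ψ z := hψ.contDiffAt (hΩ.mem_nhds hz)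
  exact (h1.differentiableAt (by norm_num)).hasFDerivAt

theorem hess_continuousOn {n : ℕ} {Ω : Set (E n)} (hΩ : IsOpen Ω) {ψ : E n → ℝ}
    (hψ : ContDiffOn ℝ 2 ψ Ω) : ContinuousOn (fderiv ℝ (fderiv ℝ ψ)) Ω := by
  have h1 : ContDiffOn ℝ 1 (fderiv ℝ ψ) Ω := hψ.fderiv_of_isOpen hΩ (by norm_num)
  have h2 : ContDiffOn ℝ 0 (fderiv ℝ (fderiv ℝ ψ)) Ω := h1.fderiv_of_isOpen hΩ (by norm_num)
  exact h2.continuousOn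

theorem hess_nonneg {n : ℕ} {Ω : Set (E n)} (hΩ : IsOpen Ω) {ψ : E n → ℝ}
    (hψ : ContDiffOn ℝ 2 ψ Ω) (hconv : ConvexOn ℝ Ω ψ) (z : E n) (hz : z ∈ Ω) (v : E n) :
    0 ≤ fderiv ℝ (fderiv ℝ ψ) z v v := by
  set f : ℝ → E n := fun t => z + t • v with hf
  have hfd : ∀ t, HasDerivAt f v t := fun t => by
    simpa [hf] using ((hasDerivAt_id t).smul_const v).const_add z
  set S : Set ℝ := f ⁻¹' Ω with hS
  have hSo : IsOpen S := hΩ.preimage (by fun_prop)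
  have h0 : (0:ℝ) ∈ S := by simpa [hS, hf] using hz
  have hfaff : f = fun t => AffineMap.lineMap (k := ℝ) z (z + v) t := by
    ext t; simp [hf, AffineMap.lineMap_apply]; ring
  have hcv : ConvexOn ℝ S (ψ ∘ f) := by
    have := hconv.comp_affineMap (AffineMap.lineMap (k := ℝ) z (z + v))
    rw [hS, hfaff]; exact this
  have hd : ∀ t ∈ S, HasDerivAt (ψ ∘ f) (fderiv ℝ ψ (f t) v) t := fun t ht =>
    (psi_hasFDerivAt hΩ hψ _ ht).comp_hasDerivAt t (hfd t)
  have hm := hcv.monotoneOn_deriv fun t ht => (hd t ht).differentiableAt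
  have hnn : 0 ≤ derivWithin (deriv (ψ ∘ f)) S 0 := hm.derivWithin_nonneg
  rw [derivWithin_of_isOpen hSo h0] at hnn
  have h2 : HasDerivAt (fun t => fderiv ℝ ψ (f t) v) (fderiv ℝ (fderiv ℝ ψ) z v v) 0 := by
    have hz' : f 0 = z := by simp [hf]
    have := (hess_hasFDerivAt hΩ hψ (f 0) h0).comp_hasDerivAt 0 (hfd 0)
    have h3 := this.clm_apply (hasDerivAt_const 0 v)
    simpa [hz'] using h3
  have h3 : deriv (ψ ∘ f) =ᶠ[nhds 0] fun t => fderiv ℝ ψ (f t) v :=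
    Filter.eventually_of_mem (hSo.mem_nhds h0) fun t ht => (hd t ht).deriv
  rwa [h3.deriv_eq, h2.deriv] at hnn

theorem quad_sum {n : ℕ} {κ : Type*} [Fintype κ] (B : E n →L[ℝ] E n →L[ℝ] ℝ) (c : κ → E n)
    (x : κ → ℝ) : star x ⬝ᵥ (Matrix.of fun i j => B (c i) (c j)).mulVec x =
      B (∑ i, x i • c i) (∑ i, x i • c i) := by
  simp only [map_sum, map_smul, dotProduct, Matrix.mulVec, sum_apply,
    smul_apply, smul_eq_mul, Matrix.of_apply, star_trivial]
  simp_rw [Finset.mul_sum]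
  rw [Finset.sum_comm]
  refine Finset.sum_congr rfl fun i _ => Finset.sum_congr rfl fun j _ => by ring

theorem posSemidef_fam {n : ℕ} {κ : Type*} [Fintype κ] (B : E n →L[ℝ] E n →L[ℝ] ℝ)
    (hs : ∀ u v, B u v = B v u) (hn : ∀ v, 0 ≤ B v v) (c : κ → E n) :
    (Matrix.of fun i j => B (c i) (c j)).PosSemidef := by
  refine Matrix.PosSemidef.of_dotProduct_mulVec_nonneg ?_ fun x => ?_
  · ext i j; simp [hs (c j) (c i)]
  · rw [quad_sum]; exact hn _

theorem det_onb {n : ℕ} {κ : Type*} [Fintype κ] [DecidableEq κ] (B : E n →L[ℝ] E n →L[ℝ] ℝ)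
    (b : OrthonormalBasis κ ℝ (E n)) :
    (Matrix.of fun i j => B (b i) (b j)).det =
    (Matrix.of fun i j : Fin n => B (EuclideanSpace.single i 1) (EuclideanSpace.single j 1)).det := by
  have hcard : Fintype.card κ = Fintype.card (Fin n) := by
    rw [← Module.finrank_eq_card_basis b.toBasis]; simp
  let e : κ ≃ Fin n := Fintype.equivOfCardEq hcard
  let b' := b.reindex e
  have h1 : (Matrix.of fun i j => B (b i) (b j)) = (Matrix.of fun i j => B (b' i) (b' j)).submatrix e e := by
    ext i j; simp [b']
  rw [h1, Matrix.det_submatrix_equiv_self]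
  let s := EuclideanSpace.basisFun (Fin n) ℝ
  let Bf : LinearMap.BilinForm ℝ (E n) := LinearMap.mk₂ ℝ (fun u v => B u v) (by simp) (by simp) (by simp) (by simp)
  have h2 := LinearMap.BilinForm.toMatrix_mul_basis_toMatrix s.toBasis b'.toBasis Bf
  have e1 : LinearMap.BilinForm.toMatrix b'.toBasis Bf = (Matrix.of fun i j => B (b' i) (b' j)) := by
    ext i j; simp [LinearMap.BilinForm.toMatrix_apply, Bf]
  have e2 : LinearMap.BilinForm.toMatrix s.toBasis Bf = (Matrix.of fun i j : Fin n => B (EuclideanSpace.single i 1) (EuclideanSpace.single j 1)) := by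
    ext i j; simp [LinearMap.BilinForm.toMatrix_apply, Bf, s]
  rw [e1, e2] at h2
  rw [← h2, Matrix.det_mul, Matrix.det_mul, Matrix.det_transpose]
  have h3 : (s.toBasis.toMatrix b'.toBasis).det ^ 2 = 1 := by
    have h4 := s.det_to_matrix_orthonormalBasis_real b'
    rw [Module.Basis.det_apply] at h4
    have h5 : s.toBasis.toMatrix ⇑b'.toBasis = s.toBasis.toMatrix ⇑b' := by simp
    rw [h5]
    rcases h4 with h4 | h4 <;> rw [h4] <;> norm_num
  linear_combination (Matrix.of fun i j : Fin n => B (EuclideanSpace.single i 1) (EuclideanSpace.single j 1)).det * h3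

theorem posDef_onb {n : ℕ} {κ : Type*} [Fintype κ] [DecidableEq κ] (B : E n →L[ℝ] E n →L[ℝ] ℝ)
    (hs : ∀ u v, B u v = B v u) (hn : ∀ v, 0 ≤ B v v) (b : OrthonormalBasis κ ℝ (E n))
    (hd : 0 < (Matrix.of fun i j : Fin n =>
      B (EuclideanSpace.single i 1) (EuclideanSpace.single j 1)).det) :
    (Matrix.of fun i j => B (b i) (b j)).PosDef := by
  rw [(posSemidef_fam B hs hn b).posDef_iff_det_ne_zero, det_onb]
  exact hd.ne'

theorem pos_of_det {n : ℕ} (B : E n →L[ℝ] E n →L[ℝ] ℝ)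
    (hs : ∀ u v, B u v = B v u) (hn : ∀ v, 0 ≤ B v v)
    (hd : 0 < (Matrix.of fun i j : Fin n =>
      B (EuclideanSpace.single i 1) (EuclideanSpace.single j 1)).det) (v : E n) (hv : v ≠ 0) :
    0 < B v v := by
  have h := posDef_onb B hs hn (EuclideanSpace.basisFun (Fin n) ℝ) hd
  have h2 := h.dotProduct_mulVec_pos (x := fun i => v i) (by
    intro h0; apply hv; ext i; exact congrFun h0 i)
  rw [quad_sum] at h2
  have hv : ∑ i, v i • (EuclideanSpace.basisFun (Fin n) ℝ) i = v := by
    simpa using (EuclideanSpace.basisFun (Fin n) ℝ).sum_repr v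
  rwa [hv] at h2

theorem hess_symm {n : ℕ} {Ω : Set (E n)} (hΩ : IsOpen Ω) {ψ : E n → ℝ}
    (hψ : ContDiffOn ℝ 2 ψ Ω) (z : E n) (hz : z ∈ Ω) (u v : E n) :
    fderiv ℝ (fderiv ℝ ψ) z u v = fderiv ℝ (fderiv ℝ ψ) z v u :=
  (hψ.contDiffAt (hΩ.mem_nhds hz)).isSymmSndFDerivAt (by simp) u v

theorem hessDet_eq {n : ℕ} (ψ : E n → ℝ) (z : E n) : hessDet ψ z = (Matrix.of fun i j : Fin n =>
      fderiv ℝ (fderiv ℝ ψ) z (EuclideanSpace.single i 1) (EuclideanSpace.single j 1)).det := by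
  simp [hessDet, iteratedFDeriv_two_apply]

theorem tangent_le {n : ℕ} {Ω : Set (E n)} {ψ : E n → ℝ} (hconv : ConvexOn ℝ Ω ψ)
    (z w : E n) (hz : z ∈ Ω) (hw : w ∈ Ω) (f : E n →L[ℝ] ℝ) (hf : HasFDerivAt ψ f z) :
    ψ z + f (w - z) ≤ ψ w := by
  have hl : HasDerivAt (fun t : ℝ => AffineMap.lineMap (k := ℝ) z w t) (w - z) 0 :=
    AffineMap.hasDerivAt_lineMap
  have hcv := hconv.comp_affineMap (AffineMap.lineMap (k := ℝ) z w)
  have hd : HasDerivAt (ψ ∘ (AffineMap.lineMap (k := ℝ) z w)) (f (w - z)) 0 := by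
    have hf' : HasFDerivAt ψ f (AffineMap.lineMap (k := ℝ) z w (0:ℝ)) := by simpa using hf
    exact hf'.comp_hasDerivAt (0:ℝ) hl
  have := hcv.le_slope_of_hasDerivAt (x := 0) (y := 1) (by simpa using hz) (by simpa using hw) one_pos hd
  simp [slope_def_field] at this
  rw [map_sub]
  linarith

/-- The integration step (Fubini and the arithmetic-geometric mean inequality). -/
theorem integrate {d m : ℕ} (X : Set (E d)) (Y : Set (E m)) (hX : MeasurableSet X)
    (hY : MeasurableSet Y) (a b : E d × E m → ℝ) (ha : ContinuousOn a (X ×ˢ Y))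
    (hb : ContinuousOn b (X ×ˢ Y)) (hapos : ∀ p ∈ X ×ˢ Y, 0 ≤ a p)
    (hbpos : ∀ p ∈ X ×ˢ Y, 0 ≤ b p) (lam : ℝ) (hlam : 0 < lam)
    (hab : ∀ p ∈ X ×ˢ Y, 1 / lam ^ 2 ≤ a p * b p) (w : E m → ℝ) (hw : Continuous w)
    (hwpos : ∀ y, 0 < w y) (q M K : ℝ) (hq : 0 < q) (hM : 0 < M) (hK : 0 ≤ K)
    (hJ : ∫⁻ y in Y, ENNReal.ofReal (w y) ≠ ∞)
    (hXv : volume X = ENNReal.ofReal (q * M))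
    (hA : ∀ y ∈ Y, ∫⁻ x in X, ENNReal.ofReal (a (x, y)) ≤ ENNReal.ofReal (q⁻¹ * (w y)⁻¹ * M))
    (hB : ∀ x ∈ X, ∫⁻ y in Y, ENNReal.ofReal (b (x, y)) ≤ ENNReal.ofReal K) :
    ∫⁻ y in Y, ENNReal.ofReal (w y) ≤ ENNReal.ofReal (lam ^ 2 * (q⁻¹) ^ 2 * K) := by
  set μ : Measure (E d) := volume.restrict X
  set ν : Measure (E m) := volume.restrict Y
  have hprod : μ.prod ν = (volume.prod volume).restrict (X ×ˢ Y) := Measure.prod_restrict X Y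
  have hXY : MeasurableSet (X ×ˢ Y) := hX.prod hY
  set θ : ℝ := q ^ 2 / lam with hθ
  have hθ0 : 0 < θ := by positivity
  have hma : AEMeasurable (fun p => ENNReal.ofReal (a p)) (μ.prod ν) := by
    rw [hprod]; exact (ha.aemeasurable hXY).ennreal_ofReal
  have hmb : AEMeasurable (fun p => ENNReal.ofReal (b p)) (μ.prod ν) := by
    rw [hprod]; exact (hb.aemeasurable hXY).ennreal_ofReal
  have hmw : Measurable (fun p : E d × E m => ENNReal.ofReal (θ * w p.2 ^ 2)) := by
    have : Continuous (fun p : E d × E m => θ * w p.2 ^ 2) := by fun_prop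
    exact this.measurable.ennreal_ofReal
  have hmm : AEMeasurable (fun p : E d × E m => ENNReal.ofReal (θ * w p.2 ^ 2) *
      ENNReal.ofReal (a p)) (μ.prod ν) := hmw.aemeasurable.mul hma
  have hpt : ∀ p ∈ X ×ˢ Y, ENNReal.ofReal (2 / lam * w p.2) ≤
      ENNReal.ofReal (θ * w p.2 ^ 2) * ENNReal.ofReal (a p) +
        ENNReal.ofReal θ⁻¹ * ENNReal.ofReal (b p) := by
    intro p hp
    have h1 := hapos p hp
    have h2 := hbpos p hp
    have h3 := hab p hp
    have h4 := hwpos p.2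
    rw [← ENNReal.ofReal_mul (by positivity), ← ENNReal.ofReal_mul (by positivity),
      ← ENNReal.ofReal_add (by positivity) (by positivity)]
    apply ENNReal.ofReal_le_ofReal
    set s := θ * w p.2 ^ 2 * a p
    set t := θ⁻¹ * b p
    have hs : 0 ≤ s := by positivity
    have ht : 0 ≤ t := by positivity
    have hst : w p.2 ^ 2 * (1 / lam ^ 2) ≤ s * t := by
      have : s * t = w p.2 ^ 2 * (a p * b p) := by
        simp only [s, t]; field_simp
      rw [this]; gcongr
    refine abs_le_of_sq_le_sq' ?_ (by positivity) |>.2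
    have e : (2 / lam * w p.2) ^ 2 = 4 * (w p.2 ^ 2 * (1 / lam ^ 2)) := by field_simp; ring
    rw [e]
    nlinarith [sq_nonneg (s - t)]
  have hmain : ∫⁻ p, ENNReal.ofReal (2 / lam * w p.2) ∂(μ.prod ν) ≤
      ∫⁻ p, ENNReal.ofReal (θ * w p.2 ^ 2) * ENNReal.ofReal (a p) ∂(μ.prod ν) +
      ∫⁻ p, ENNReal.ofReal θ⁻¹ * ENNReal.ofReal (b p) ∂(μ.prod ν) := by
    rw [← lintegral_add_left' hmm]
    rw [hprod]
    exact setLIntegral_mono' hXY hpt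
  set J := ∫⁻ y in Y, ENNReal.ofReal (w y) with hJdef
  have e1 : ∫⁻ p, ENNReal.ofReal (2 / lam * w p.2) ∂(μ.prod ν) =
      ENNReal.ofReal (q * M) * (ENNReal.ofReal (2 / lam) * J) := by
    rw [lintegral_prod _ (by
      have : Continuous (fun p : E d × E m => 2 / lam * w p.2) := by fun_prop
      exact this.measurable.ennreal_ofReal.aemeasurable)]
    simp only [lintegral_const]
    rw [mul_comm]
    congr 1
    · simp [μ, hXv]
    · rw [hJdef, ← lintegral_const_mul _ hw.measurable.ennreal_ofReal]
      refine lintegral_congr fun y => ?_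
      rw [ENNReal.ofReal_mul (by positivity)]
  have e2 : ∫⁻ p, ENNReal.ofReal (θ * w p.2 ^ 2) * ENNReal.ofReal (a p) ∂(μ.prod ν) ≤
      ENNReal.ofReal (θ * q⁻¹ * M) * J := by
    rw [lintegral_prod_symm _ hmm, hJdef,
      ← lintegral_const_mul _ hw.measurable.ennreal_ofReal]
    refine setLIntegral_mono' hY fun y hy => ?_
    simp only
    have h4 := hwpos y
    rw [lintegral_const_mul' _ _ ENNReal.ofReal_ne_top]
    refine (mul_le_mul_right (hA y hy) _).trans ?_
    rw [← ENNReal.ofReal_mul (by positivity), ← ENNReal.ofReal_mul (by positivity)]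
    apply ENNReal.ofReal_le_ofReal
    apply le_of_eq
    field_simp
  have e3 : ∫⁻ p, ENNReal.ofReal θ⁻¹ * ENNReal.ofReal (b p) ∂(μ.prod ν) ≤
      ENNReal.ofReal θ⁻¹ * (ENNReal.ofReal K * ENNReal.ofReal (q * M)) := by
    rw [lintegral_const_mul' _ _ ENNReal.ofReal_ne_top, lintegral_prod _ hmb]
    gcongr
    refine (setLIntegral_mono' hX (g := fun _ => ENNReal.ofReal K) hB).trans ?_
    simp [hXv]
  have h := hmain.trans (add_le_add e2 e3)
  rw [e1] at h
  obtain ⟨j, hj0, hj⟩ : ∃ j : ℝ, 0 ≤ j ∧ J = ENNReal.ofReal j :=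
    ⟨J.toReal, ENNReal.toReal_nonneg, (ENNReal.ofReal_toReal hJ).symm⟩
  rw [hj] at h ⊢
  rw [← ENNReal.ofReal_mul (by positivity), ← ENNReal.ofReal_mul (by positivity),
    ← ENNReal.ofReal_mul (by positivity), ← ENNReal.ofReal_mul (by positivity),
    ← ENNReal.ofReal_mul (by positivity), ← ENNReal.ofReal_add (by positivity) (by positivity),
    ENNReal.ofReal_le_ofReal_iff (by positivity)] at h
  apply ENNReal.ofReal_le_ofReal
  have h' : q * M / lam * j ≤ lam * M / q * K := by
    have a1 : q * M * (2 / lam * j) = 2 * (q * M / lam * j) := by ring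
    have a2 : θ * q⁻¹ * M * j = q * M / lam * j := by rw [hθ]; field_simp
    have a3 : θ⁻¹ * (K * (q * M)) = lam * M / q * K := by rw [hθ]; field_simp
    rw [a1, a2, a3] at h
    linarith
  have h'' := mul_le_mul_of_nonneg_left h' (show 0 ≤ lam / (q * M) by positivity)
  have a4 : lam / (q * M) * (q * M / lam * j) = j := by field_simp
  have a5 : lam / (q * M) * (lam * M / q * K) = lam ^ 2 * (q⁻¹) ^ 2 * K := by field_simp
  rwa [a4, a5] at h''


theorem exists_onb {n d m : ℕ} (hnm : d + m = n) (ι₁ : E d →ₗᵢ[ℝ] E n) (ι₂ : E m →ₗᵢ[ℝ] E n)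
    (horth : ∀ x y, ⟪ι₁ x, ι₂ y⟫ = 0) :
    ∃ b : OrthonormalBasis (Fin d ⊕ Fin m) ℝ (E n),
      (∀ i, b (Sum.inl i) = ι₁ (EuclideanSpace.single i 1)) ∧
      (∀ i, b (Sum.inr i) = ι₂ (EuclideanSpace.single i 1)) := by
  let c : Fin d ⊕ Fin m → E n := Sum.elim (fun i => ι₁ (EuclideanSpace.single i 1))
    (fun i => ι₂ (EuclideanSpace.single i 1))
  have hc : Orthonormal ℝ c := by
    classical
    rw [orthonormal_iff_ite]
    rintro (i | i) (j | j)
    · simp [c, EuclideanSpace.inner_single_left]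
    · simp [c, horth]
    · simp [c, horth, real_inner_comm]
    · simp [c, EuclideanSpace.inner_single_left]
  have hcard : Fintype.card (Fin d ⊕ Fin m) = Module.finrank ℝ (E n) := by simp [hnm]
  have hsp := hc.linearIndependent.span_eq_top_of_card_eq_finrank' hcard
  refine ⟨OrthonormalBasis.mk hc hsp.ge, fun i => ?_, fun i => ?_⟩ <;> simp [c]

theorem key {n d m : ℕ} (hnm : d + m = n) (ι₁ : E d →ₗᵢ[ℝ] E n) (ι₂ : E m →ₗᵢ[ℝ] E n)
    (horth : ∀ x y, ⟪ι₁ x, ι₂ y⟫ = 0) {Ω : Set (E n)} (hΩ : IsOpen Ω) {ψ : E n → ℝ}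
    (hψ : ContDiffOn ℝ 2 ψ Ω) (hconv : ConvexOn ℝ Ω ψ) (hnn : ∀ x ∈ Ω, 0 ≤ ψ x)
    (lam : ℝ) (hlam : 0 < lam) (hdet : ∀ x ∈ Ω, 1 / lam ^ 2 ≤ hessDet ψ x)
    (x₀ : E n) (δ : ℝ) (hball : ball x₀ δ ⊆ Ω) (L : ℝ) (hL0 : 0 < L)
    (hL : ∀ x ∈ Ω, ‖fderiv ℝ ψ x‖ ≤ L) (ℓ : ℝ) (hℓ : 0 < ℓ) (hℓδ : ℓ ≤ δ / 2)
    (r : ℝ) (hrδ : r ≤ δ / 2) (h : ℝ) (hh0 : 0 < h)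
    (hh : ∀ x : E d, ‖x‖ ≤ ℓ → ψ (x₀ + ι₁ x) ≤ h) :
    ∫⁻ y in ball (0 : E m) r, ENNReal.ofReal (((h + L * ‖y‖) ^ d)⁻¹) ≤
      ENNReal.ofReal (lam ^ 2 * ((2 / ℓ) ^ d) ^ 2 * (L ^ m * volume.real (ball (0 : E m) 1))) := by
  have hmem : ∀ (x : E d) (y : E m), ‖x‖ ≤ ℓ → ‖y‖ < r → x₀ + ι₁ x + ι₂ y ∈ Ω := by
    intro x y hx hy
    apply hball
    rw [mem_ball_iff_norm, add_assoc, add_sub_cancel_left]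
    calc ‖ι₁ x + ι₂ y‖ ≤ ‖ι₁ x‖ + ‖ι₂ y‖ := norm_add_le _ _
      _ = ‖x‖ + ‖y‖ := by simp
      _ < δ := by linarith
  have hdpos : ∀ z ∈ Ω, 0 < (Matrix.of fun i j : Fin n =>
      fderiv ℝ (fderiv ℝ ψ) z (EuclideanSpace.single i 1) (EuclideanSpace.single j 1)).det := by
    intro z hz
    rw [← hessDet_eq]
    exact lt_of_lt_of_le (by positivity) (hdet z hz)
  have hpos : ∀ z ∈ Ω, ∀ v, v ≠ 0 → 0 < fderiv ℝ (fderiv ℝ ψ) z v v := fun z hz =>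
    pos_of_det _ (hess_symm hΩ hψ z hz) (hess_nonneg hΩ hψ hconv z hz) (hdpos z hz)
  obtain ⟨b, hb1, hb2⟩ := exists_onb hnm ι₁ ι₂ horth
  let z : E d × E m → E n := fun p => x₀ + ι₁ p.1 + ι₂ p.2
  have hz : Continuous z := by
    have h1 := ι₁.continuous
    have h2 := ι₂.continuous
    fun_prop
  let A : E d × E m → ℝ := fun p => Matrix.det (Matrix.of fun i j : Fin d =>
      fderiv ℝ (fderiv ℝ ψ) (z p) (ι₁ (EuclideanSpace.single i 1)) (ι₁ (EuclideanSpace.single j 1)))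
  let B : E d × E m → ℝ := fun p => Matrix.det (Matrix.of fun i j : Fin m =>
      fderiv ℝ (fderiv ℝ ψ) (z p) (ι₂ (EuclideanSpace.single i 1)) (ι₂ (EuclideanSpace.single j 1)))
  set X : Set (E d) := ball 0 (ℓ / 2)
  set Y : Set (E m) := ball 0 r
  have hzΩ : ∀ p ∈ X ×ˢ Y, z p ∈ Ω := by
    rintro ⟨x, y⟩ ⟨hx, hy⟩
    simp only [X, Y, mem_ball_zero_iff] at hx hy
    exact hmem x y (by linarith) hy
  have hcont : ContinuousOn (fun p => fderiv ℝ (fderiv ℝ ψ) (z p)) (X ×ˢ Y) :=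
    (hess_continuousOn hΩ hψ).comp hz.continuousOn hzΩ
  have hPD : ∀ p ∈ X ×ˢ Y, (Matrix.of fun i j => fderiv ℝ (fderiv ℝ ψ) (z p) (b i) (b j)).PosDef :=
    fun p hp => posDef_onb _ (hess_symm hΩ hψ _ (hzΩ p hp))
      (hess_nonneg hΩ hψ hconv _ (hzΩ p hp)) b (hdpos _ (hzΩ p hp))
  have hA1 : ∀ p, (Matrix.of fun i j => fderiv ℝ (fderiv ℝ ψ) (z p) (b i) (b j)).toBlocks₁₁ =
      Matrix.of fun i j : Fin d => fderiv ℝ (fderiv ℝ ψ) (z p)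
        (ι₁ (EuclideanSpace.single i 1)) (ι₁ (EuclideanSpace.single j 1)) := by
    intro p; ext i j; simp [Matrix.toBlocks₁₁, hb1]
  have hB1 : ∀ p, (Matrix.of fun i j => fderiv ℝ (fderiv ℝ ψ) (z p) (b i) (b j)).toBlocks₂₂ =
      Matrix.of fun i j : Fin m => fderiv ℝ (fderiv ℝ ψ) (z p)
        (ι₂ (EuclideanSpace.single i 1)) (ι₂ (EuclideanSpace.single j 1)) := by
    intro p; ext i j; simp [Matrix.toBlocks₂₂, hb2]
  have hκd : volume (ball (0 : E d) 1) = ENNReal.ofReal (volume.real (ball (0 : E d) 1)) :=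
    (ENNReal.ofReal_toReal measure_ball_lt_top.ne).symm
  have hκm : volume (ball (0 : E m) 1) = ENNReal.ofReal (volume.real (ball (0 : E m) 1)) :=
    (ENNReal.ofReal_toReal measure_ball_lt_top.ne).symm
  have hw0 : ∀ y : E m, 0 < h + L * ‖y‖ := fun y => by positivity
  have e := integrate X Y isOpen_ball.measurableSet isOpen_ball.measurableSet A B ?_ ?_ ?_ ?_ lam hlam ?_
    (fun y => ((h + L * ‖y‖) ^ d)⁻¹) ?_ (fun y => inv_pos.mpr (pow_pos (hw0 y) _))
    ((ℓ / 2) ^ d) (volume.real (ball (0 : E d) 1))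
    (L ^ m * volume.real (ball (0 : E m) 1)) (by positivity) ?_ (by positivity) ?_ ?_ ?_ ?_
  · have e3 : ((2 / ℓ) ^ d) = ((ℓ / 2) ^ d)⁻¹ := by rw [← inv_pow, inv_div]
    rw [e3]; exact e
  · refine (Continuous.matrix_det (n := Fin d) (R := ℝ) continuous_id).comp_continuousOn ?_
    refine continuousOn_pi.mpr fun i => continuousOn_pi.mpr fun j => ?_
    exact (hcont.clm_apply continuousOn_const).clm_apply continuousOn_const
  · refine (Continuous.matrix_det (n := Fin m) (R := ℝ) continuous_id).comp_continuousOn ?_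
    refine continuousOn_pi.mpr fun i => continuousOn_pi.mpr fun j => ?_
    exact (hcont.clm_apply continuousOn_const).clm_apply continuousOn_const
  · intro p hp
    have := ((hPD p hp).submatrix Sum.inl_injective).det_pos.le
    change 0 ≤ (Matrix.toBlocks₁₁ _).det at this
    rwa [hA1] at this
  · intro p hp
    have := ((hPD p hp).submatrix Sum.inr_injective).det_pos.le
    change 0 ≤ (Matrix.toBlocks₂₂ _).det at this
    rwa [hB1] at this
  · intro p hp
    have := fischer _ (hPD p hp)
    rw [hA1, hB1, det_onb, ← hessDet_eq] at this
    exact (hdet _ (hzΩ p hp)).trans this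
  · exact Continuous.inv₀ (by fun_prop) fun y => (pow_pos (hw0 y) _).ne'
  · exact ENNReal.toReal_pos (measure_ball_pos _ _ one_pos).ne' measure_ball_lt_top.ne
  · refine ne_of_lt (lt_of_le_of_lt (lintegral_mono (g := fun _ => ENNReal.ofReal ((h ^ d)⁻¹))
      fun y => ENNReal.ofReal_le_ofReal ?_) ?_)
    · have : 0 ≤ L * ‖y‖ := by positivity
      gcongr
      linarith
    · rw [lintegral_const]
      exact ENNReal.mul_lt_top ENNReal.ofReal_lt_top (by simpa using measure_ball_lt_top)
  · rw [Measure.addHaar_ball_of_pos _ _ (by positivity), hκd, ENNReal.ofReal_mul (by positivity)]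
    simp
  · intro y hy
    have hy' : ‖y‖ < r := by simpa [Y] using hy
    have hzeq : ∀ x, x₀ + ι₂ y + ι₁ x = z (x, y) := fun x => by simp only [z]; abel
    have := slice hΩ hψ ι₁.toContinuousLinearMap ι₁.injective (x₀ + ι₂ y) hpos X isOpen_ball
      (convex_ball _ _) ?_ ((ℓ / 2)⁻¹ * (h + L * ‖y‖)) (by positivity) ?_
    · simp only [LinearIsometry.coe_toContinuousLinearMap, hzeq] at this
      refine this.trans (le_of_eq ?_)
      rw [hκd, ← ENNReal.ofReal_mul (by positivity), inv_inv, mul_pow, inv_pow]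
    · intro x hx
      simp only [LinearIsometry.coe_toContinuousLinearMap, hzeq]
      exact hzΩ (x, y) ⟨hx, hy⟩
    · intro x hx v
      have hx' : ‖x‖ < ℓ / 2 := by simpa [X] using hx
      simp only [LinearIsometry.coe_toContinuousLinearMap, hzeq]
      rcases eq_or_ne v 0 with rfl | hv
      · simp
      have hv' : 0 < ‖v‖ := norm_pos_iff.mpr hv
      set c : ℝ := (ℓ / 2) / ‖v‖ with hc
      have hc0 : 0 < c := by positivity
      have hcv : ‖c • v‖ = ℓ / 2 := by
        rw [norm_smul, Real.norm_of_nonneg hc0.le, hc]; field_simp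
      have hx1 : ‖x + c • v‖ ≤ ℓ := by
        have := norm_add_le x (c • v); linarith
      have hzin := hzΩ (x, y) ⟨hx, hy⟩
      have hin2 := hmem (x + c • v) y hx1 hy'
      have hin3 : x₀ + ι₁ (x + c • v) ∈ Ω := by
        have := hmem (x + c • v) 0 hx1 (lt_of_le_of_lt (by simp) hy')
        simpa using this
      have t1 := tangent_le hconv (z (x, y)) _ hzin hin2 _ (psi_hasFDerivAt hΩ hψ _ hzin)
      have hdiff : x₀ + ι₁ (x + c • v) + ι₂ y - z (x, y) = c • ι₁ v := by
        simp only [z, map_add, map_smul]; abel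
      rw [hdiff, map_smul, smul_eq_mul] at t1
      have t2 := hconv.1.norm_image_sub_le_of_norm_hasFDerivWithin_le (f := ψ) (C := L)
        (fun w hw => (psi_hasFDerivAt hΩ hψ w hw).hasFDerivWithinAt) hL hin3 hin2
      rw [add_sub_cancel_left, LinearIsometry.norm_map] at t2
      have t3 := (le_abs_self _).trans t2
      have t4 := hh _ hx1
      have t5 := hnn _ hzin
      have t6 : c * fderiv ℝ ψ (z (x, y)) (ι₁ v) ≤ h + L * ‖y‖ := by linarith
      have t7 : fderiv ℝ ψ (z (x, y)) (ι₁ v) ≤ (h + L * ‖y‖) / c := by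
        rw [le_div_iff₀ hc0]; linarith
      refine t7.trans (le_of_eq ?_)
      rw [hc]; field_simp
  · intro x hx
    have := slice hΩ hψ ι₂.toContinuousLinearMap ι₂.injective (x₀ + ι₁ x) hpos Y isOpen_ball
      (convex_ball _ _) ?_ L hL0.le ?_
    · refine this.trans (le_of_eq ?_)
      rw [hκm, ← ENNReal.ofReal_mul (by positivity)]
    · intro y hy
      exact hzΩ (x, y) ⟨hx, hy⟩
    · intro y hy v
      refine (le_abs_self _).trans ?_
      refine ((fderiv ℝ ψ _).le_opNorm _).trans ?_
      simp only [LinearIsometry.coe_toContinuousLinearMap, LinearIsometry.norm_map]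
      gcongr
      exact hL _ (hzΩ (x, y) ⟨hx, hy⟩)


theorem lower_ball {d m : ℕ} (h L r K : ℝ) (hh : 0 < h) (hL : 0 < L) (hr : 0 < r) (hK : 0 ≤ K)
    (H : ∫⁻ y in ball (0 : E m) r, ENNReal.ofReal (((h + L * ‖y‖) ^ d)⁻¹) ≤
      ENNReal.ofReal (K * volume.real (ball (0 : E m) 1))) :
    ((h + L * r) ^ d)⁻¹ * r ^ m ≤ K := by
  have hκ : volume (ball (0 : E m) 1) = ENNReal.ofReal (volume.real (ball (0 : E m) 1)) :=
    (ENNReal.ofReal_toReal measure_ball_lt_top.ne).symm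
  have hκ0 : 0 < volume.real (ball (0 : E m) 1) :=
    ENNReal.toReal_pos (measure_ball_pos _ _ one_pos).ne' measure_ball_lt_top.ne
  have h1 : ∫⁻ y in ball (0 : E m) r, ENNReal.ofReal (((h + L * r) ^ d)⁻¹) ≤
      ∫⁻ y in ball (0 : E m) r, ENNReal.ofReal (((h + L * ‖y‖) ^ d)⁻¹) := by
    refine setLIntegral_mono' isOpen_ball.measurableSet fun y hy => ENNReal.ofReal_le_ofReal ?_
    rw [mem_ball_zero_iff] at hy
    gcongr
  have h2 := h1.trans H
  rw [setLIntegral_const, Measure.addHaar_ball_of_pos _ _ hr, hκ, finrank_euclideanSpace_fin,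
    ← ENNReal.ofReal_mul (by positivity), ← ENNReal.ofReal_mul (by positivity),
    ENNReal.ofReal_le_ofReal_iff (by positivity), ← mul_assoc] at h2
  exact le_of_mul_le_mul_right h2 hκ0

theorem lower_log {m : ℕ} (hm : 1 ≤ m) (h L r K : ℝ) (hh : 0 < h) (hL : 0 < L) (hr : h / L ≤ r)
    (hK : 0 ≤ K)
    (H : ∫⁻ y in ball (0 : E m) r, ENNReal.ofReal (((h + L * ‖y‖) ^ m)⁻¹) ≤
      ENNReal.ofReal (K * volume.real (ball (0 : E m) 1))) :
    m * ((2 * L) ^ m)⁻¹ * Real.log (r / (h / L)) ≤ K := by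
  have hκ0 : 0 < volume.real (ball (0 : E m) 1) :=
    ENNReal.toReal_pos (measure_ball_pos _ _ one_pos).ne' measure_ball_lt_top.ne
  have hs0 : 0 < h / L := by positivity
  set s := h / L with hs
  have _ : Nonempty (Fin m) := ⟨⟨0, hm⟩⟩
  let f : ℝ → ℝ := (Ioo s r).indicator fun t => ((2 * L * t) ^ m)⁻¹
  have hpt : ∀ t ∈ Ioi (0:ℝ), t ^ (m - 1) • f t =
      (Ioo s r).indicator (fun t => ((2 * L) ^ m)⁻¹ * t⁻¹) t := by
    intro t ht
    have ht' : (0:ℝ) < t := ht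
    by_cases hmem : t ∈ Ioo s r
    · simp only [f, indicator_of_mem hmem, smul_eq_mul]
      obtain ⟨k, rfl⟩ : ∃ k, m = k + 1 := ⟨m - 1, by omega⟩
      rw [Nat.add_sub_cancel, mul_pow _ t, pow_succ t]
      field_simp
    · simp [f, indicator_of_notMem hmem]
  have hci : ContinuousOn (fun t : ℝ => ((2 * L) ^ m)⁻¹ * t⁻¹) (Icc s r) :=
    continuousOn_const.mul (continuousOn_inv₀.mono fun t ht => (lt_of_lt_of_le hs0 ht.1).ne')
  have hint0 : IntegrableOn (fun t : ℝ => ((2 * L) ^ m)⁻¹ * t⁻¹) (Ioo s r) :=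
    (hci.integrableOn_Icc).mono_set Ioo_subset_Icc_self
  have hint : Integrable (fun y : E m => f ‖y‖) := by
    rw [integrable_fun_norm_addHaar, finrank_euclideanSpace_fin]
    refine IntegrableOn.congr_fun ?_ (fun t ht => (hpt t ht).symm) measurableSet_Ioi
    exact ((integrable_indicator_iff measurableSet_Ioo).mpr hint0).integrableOn
  have hsub : Ioo s r ⊆ Ioi 0 := fun t ht => lt_trans hs0 ht.1
  have hval : ∫ y : E m, f ‖y‖ =
      m * volume.real (ball (0 : E m) 1) * (((2 * L) ^ m)⁻¹ * Real.log (r / s)) := by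
    rw [integral_fun_norm_addHaar, finrank_euclideanSpace_fin,
      setIntegral_congr_fun measurableSet_Ioi hpt,
      setIntegral_indicator measurableSet_Ioo,
      inter_eq_right.mpr hsub, ← integral_Ioc_eq_integral_Ioo,
      ← intervalIntegral.integral_of_le hr, intervalIntegral.integral_const_mul,
      integral_inv_of_pos hs0 (lt_of_lt_of_le hs0 hr)]
    simp [mul_assoc]
  have hfnn : ∀ t, 0 ≤ f t := by
    intro t
    apply indicator_nonneg
    intro t ht
    have : 0 < t := lt_trans hs0 ht.1
    positivity
  have h1 : ENNReal.ofReal (∫ y : E m, f ‖y‖) ≤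
      ∫⁻ y in ball (0 : E m) r, ENNReal.ofReal (((h + L * ‖y‖) ^ m)⁻¹) := by
    rw [ofReal_integral_eq_lintegral_ofReal hint (ae_of_all _ fun y => hfnn _),
      ← lintegral_indicator isOpen_ball.measurableSet]
    refine lintegral_mono fun y => ?_
    by_cases hmem : ‖y‖ ∈ Ioo s r
    · have hyb : y ∈ ball (0 : E m) r := by simpa using hmem.2
      rw [indicator_of_mem hyb]
      simp only [f, indicator_of_mem hmem]
      apply ENNReal.ofReal_le_ofReal
      have h3 : h ≤ L * ‖y‖ := by
        have := hmem.1.le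
        rw [hs, div_le_iff₀ hL] at this; linarith
      gcongr
      linarith
    · simp [f, indicator_of_notMem hmem]
  have h2 := h1.trans H
  rw [hval, ENNReal.ofReal_le_ofReal_iff (by positivity)] at h2
  refine le_of_mul_le_mul_right ?_ hκ0
  linarith

theorem exists_iso {n d m : ℕ} (hnm : d + m = n) (V : Submodule ℝ (E n))
    (hV : Module.finrank ℝ V = d) : ∃ (ι₁ : E d →ₗᵢ[ℝ] E n) (ι₂ : E m →ₗᵢ[ℝ] E n),
      (∀ x y, ⟪ι₁ x, ι₂ y⟫ = 0) ∧ ∀ x, ι₁ x ∈ V := by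
  have hW : Module.finrank ℝ Vᗮ = m := by
    have := V.finrank_add_finrank_orthogonal
    rw [finrank_euclideanSpace_fin] at this
    omega
  let b₁ := (stdOrthonormalBasis ℝ V).reindex (finCongr hV)
  let b₂ := (stdOrthonormalBasis ℝ Vᗮ).reindex (finCongr hW)
  refine ⟨V.subtypeₗᵢ.comp b₁.repr.symm.toLinearIsometry,
    Vᗮ.subtypeₗᵢ.comp b₂.repr.symm.toLinearIsometry, fun x y => ?_, fun x => ?_⟩
  · exact Submodule.inner_right_of_mem_orthogonal (Submodule.coe_mem _) (Submodule.coe_mem _)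
  · exact Submodule.coe_mem _


theorem ball_subset_of_infDist {n : ℕ} {Ω : Set (E n)} (x₀ : E n) (hx : x₀ ∈ Ω) (δ : ℝ)
    (hδ : δ = infDist x₀ (frontier Ω)) (hδ0 : 0 < δ) : ball x₀ δ ⊆ Ω := by
  by_contra hcon
  rw [not_subset] at hcon
  obtain ⟨y, hy, hyΩ⟩ := hcon
  obtain ⟨w, hw, hwf⟩ : ∃ w, w ∈ ball x₀ δ ∧ w ∈ frontier Ω := by
    by_contra hno
    push Not at hno
    have hcov : ball x₀ δ ⊆ interior Ω ∪ (closure Ω)ᶜ := by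
      intro w hw
      by_contra hw'
      rw [mem_union, not_or, mem_compl_iff, not_not] at hw'
      exact hno w hw ⟨hw'.2, hw'.1⟩
    have hxi : x₀ ∈ interior Ω := by
      rcases hcov (mem_ball_self hδ0) with h | h
      · exact h
      · exact absurd (subset_closure hx) h
    have hyc : y ∈ (closure Ω)ᶜ := by
      rcases hcov hy with h | h
      · exact absurd (interior_subset h) hyΩ
      · exact h
    obtain ⟨w, _, hw1, hw2⟩ := (convex_ball x₀ δ).isPreconnected _ _ isOpen_interior
      isClosed_closure.isOpen_compl hcov ⟨x₀, mem_ball_self hδ0, hxi⟩ ⟨y, hy, hyc⟩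
    exact hw2 (subset_closure (interior_subset hw1))
  have := infDist_le_dist_of_mem (x := x₀) hwf
  rw [mem_ball, dist_comm] at hw
  linarith

/-- algebra for `d > n/2`. -/
theorem alg1 {n d m : ℕ} (hnm : d + m = n) (hdm : m < d) (lam L ℓ h : ℝ) (hlam : 0 < lam)
    (hL : 0 < L) (hℓ : 0 < ℓ) (hh : 0 < h)
    (H : ((h + L * (h / (2 * L))) ^ d)⁻¹ * (h / (2 * L)) ^ m ≤
      lam ^ 2 * ((2 / ℓ) ^ d) ^ 2 * L ^ m) :
    (ℓ ^ (2 * d) / (16 ^ n * lam ^ 2 * L ^ (2 * n - 2 * d))) ^ (1 / (2 * (d : ℝ) - n)) ≤ h := by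
  obtain ⟨k, rfl⟩ : ∃ k, d = m + k := ⟨d - m, by omega⟩
  have hk : k ≠ 0 := by omega
  have e1 : 2 * n - 2 * (m + k) = 2 * m := by omega
  have e2 : 2 * ((m + k : ℕ) : ℝ) - n = k := by
    rw [← hnm]; push_cast; ring
  rw [e1, e2]
  have hle : ℓ ^ (2 * (m + k)) / (16 ^ n * lam ^ 2 * L ^ (2 * m)) ≤ h ^ k := by
    rw [div_le_iff₀ (by positivity)]
    have e3 : h + L * (h / (2 * L)) = 3 / 2 * h := by field_simp; ring
    rw [e3] at H
    have H2 := mul_le_mul_of_nonneg_left H (show 0 ≤ (3 / 2 * h) ^ (m + k) * (2 * L) ^ m *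
      ℓ ^ (2 * (m + k)) / h ^ m by positivity)
    have e4 : (3 / 2 * h) ^ (m + k) * (2 * L) ^ m * ℓ ^ (2 * (m + k)) / h ^ m *
        (((3 / 2 * h) ^ (m + k))⁻¹ * (h / (2 * L)) ^ m) = ℓ ^ (2 * (m + k)) := by
      rw [div_pow]; field_simp
    have e5 : (3 / 2 * h) ^ (m + k) * (2 * L) ^ m * ℓ ^ (2 * (m + k)) / h ^ m *
        (lam ^ 2 * ((2 / ℓ) ^ (m + k)) ^ 2 * L ^ m) =
        (6 ^ (m + k) * 2 ^ m) * (h ^ k * (lam ^ 2 * L ^ (2 * m))) := by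
      rw [← pow_mul, mul_comm (m + k) 2, div_pow, mul_pow (3 / 2), mul_pow 2 L, pow_add h,
        show (6:ℝ) ^ (m + k) = (3 / 2) ^ (m + k) * 2 ^ (2 * (m + k)) by
          rw [pow_mul, ← mul_pow]; norm_num, show L ^ (2 * m) = L ^ m * L ^ m by ring]
      field_simp
    rw [e4, e5] at H2
    refine H2.trans ?_
    have e6 : (6:ℝ) ^ (m + k) * 2 ^ m ≤ 16 ^ n := by
      rw [← hnm, pow_add 16]
      gcongr <;> norm_num
    calc _ ≤ 16 ^ n * (h ^ k * (lam ^ 2 * L ^ (2 * m))) := by gcongr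
      _ = _ := by ring
  calc _ ≤ (h ^ k) ^ (1 / (k : ℝ)) := Real.rpow_le_rpow (by positivity) hle (by positivity)
    _ = h := by rw [one_div, Real.pow_rpow_inv_natCast hh.le hk]

/-- algebra for `d = n/2`. -/
theorem alg2 {n d : ℕ} (hnd : 2 * d = n) (hd : 1 ≤ d) (lam L ℓ h δ : ℝ) (hlam : 0 < lam)
    (hL : 0 < L) (hℓ : 0 < ℓ) (hh : 0 < h) (hδ : 0 < δ)
    (H1 : ((δ * L + L * (δ / 2)) ^ d)⁻¹ * (δ / 2) ^ d ≤ lam ^ 2 * ((2 / ℓ) ^ d) ^ 2 * L ^ d)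
    (H2 : h / L ≤ δ / 2 → d * ((2 * L) ^ d)⁻¹ * Real.log ((δ / 2) / (h / L)) ≤
      lam ^ 2 * ((2 / ℓ) ^ d) ^ 2 * L ^ d) :
    δ * L * Real.exp (-(16 ^ n * lam ^ 2 * L ^ n / ℓ ^ n)) ≤ h := by
  set X := lam ^ 2 * L ^ n / ℓ ^ n with hX
  have hX0 : 0 < X := by positivity
  have eX : lam ^ 2 * ((2 / ℓ) ^ d) ^ 2 * L ^ d * L ^ d = 4 ^ d * X := by
    rw [hX, ← hnd, ← pow_mul, mul_comm d 2, div_pow, pow_mul 2 2 d,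
      show L ^ (2 * d) = L ^ d * L ^ d by ring]
    norm_num
    field_simp
  have h1 : 1 ≤ 12 ^ d * X := by
    have e : ((δ * L + L * (δ / 2)) ^ d)⁻¹ * (δ / 2) ^ d = ((3 * L) ^ d)⁻¹ := by
      rw [← inv_pow, ← inv_pow, ← mul_pow]
      congr 1
      field_simp; ring
    rw [e] at H1
    have := mul_le_mul_of_nonneg_left H1 (show 0 ≤ (3 * L) ^ d by positivity)
    rw [mul_inv_cancel₀ (by positivity)] at this
    calc (1:ℝ) ≤ _ := this
      _ = 3 ^ d * (lam ^ 2 * ((2 / ℓ) ^ d) ^ 2 * L ^ d * L ^ d) := by rw [mul_pow]; ring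
      _ = _ := by rw [eX, ← mul_assoc, ← mul_pow]; norm_num
  have hlog2 : Real.log 2 ≤ 12 ^ d * X := by
    have := Real.log_two_lt_d9; linarith
  have hC : 12 ^ d * X + 8 ^ d * X ≤ 16 ^ n * X := by
    rw [← add_mul]
    gcongr
    rw [← hnd, pow_mul]
    norm_num
    have a1 : (12:ℝ) ^ d ≤ 128 ^ d := by gcongr; norm_num
    have a2 : (8:ℝ) ^ d ≤ 128 ^ d := by gcongr; norm_num
    have a3 : (256:ℝ) ^ d = 2 ^ d * 128 ^ d := by rw [← mul_pow]; norm_num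
    have a4 : (2:ℝ) ≤ 2 ^ d := by
      calc (2:ℝ) = 2 ^ 1 := by norm_num
        _ ≤ 2 ^ d := pow_le_pow_right₀ (by norm_num) hd
    have a5 : (0:ℝ) < 128 ^ d := by positivity
    nlinarith
  have hlog : Real.log (δ * L / h) ≤ 16 ^ n * X := by
    rcases le_or_gt (h / L) (δ / 2) with hc | hc
    · have h3 := H2 hc
      set y := Real.log ((δ / 2) / (h / L)) with hy
      have hy0 : 0 ≤ y := Real.log_nonneg (by rw [le_div_iff₀ (by positivity)]; linarith)
      have h4 := mul_le_mul_of_nonneg_left h3 (show 0 ≤ (2 * L) ^ d by positivity)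
      have e1 : (2 * L) ^ d * (d * ((2 * L) ^ d)⁻¹ * y) = d * y := by field_simp
      have e2 : (2 * L) ^ d * (lam ^ 2 * ((2 / ℓ) ^ d) ^ 2 * L ^ d) = 8 ^ d * X := by
        calc _ = 2 ^ d * (lam ^ 2 * ((2 / ℓ) ^ d) ^ 2 * L ^ d * L ^ d) := by rw [mul_pow]; ring
          _ = _ := by rw [eX, ← mul_assoc, ← mul_pow]; norm_num
      rw [e1, e2] at h4
      have hd' : (1:ℝ) ≤ d := by exact_mod_cast hd
      have h5 : y ≤ 8 ^ d * X := by nlinarith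
      have e3 : Real.log (δ * L / h) = Real.log 2 + y := by
        rw [hy, ← Real.log_mul (by norm_num) (by positivity)]
        congr 1
        field_simp
      linarith
    · have h3 : δ * L / h ≤ 2 := by
        rw [div_le_iff₀ hh]
        rw [lt_div_iff₀ hL] at hc
        linarith
      have h4 := Real.log_le_log (by positivity) h3
      have : 0 < 8 ^ d * X := by positivity
      linarith
  have e : 16 ^ n * lam ^ 2 * L ^ n / ℓ ^ n = 16 ^ n * X := by rw [hX]; ring
  rw [e]
  have h6 : Real.exp (-(16 ^ n * X)) ≤ h / (δ * L) := by
    rw [← Real.le_log_iff_exp_le (by positivity), ← inv_div, Real.log_inv]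
    linarith
  rw [le_div_iff₀ (by positivity)] at h6
  linarith


/-- lower bounds for `sup ψ` on `B_ℓ(x₀) ∩ H` when `d ≥ n/2`. -/
theorem stmt11 : ∀ n : ℕ, 3 ≤ n → ∃ C : ℝ, 0 < C ∧
    ∀ d : ℕ, 1 ≤ d → d < n → n ≤ 2 * d →
    ∀ (Ω : Set (E n)), IsOpen Ω →
    ∀ ψ : E n → ℝ, ContDiffOn ℝ 2 ψ Ω → ConvexOn ℝ Ω ψ → (∀ x ∈ Ω, 0 ≤ ψ x) →
    ∀ lam : ℝ, 0 < lam → (∀ x ∈ Ω, 1 / lam ^ 2 ≤ hessDet ψ x) →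
    ∀ x₀ ∈ Ω, ψ x₀ = 0 →
    ∀ δ : ℝ, δ = infDist x₀ (frontier Ω) → 0 < δ →
    ∀ L : ℝ, L = sSup ((fun x => ‖gradient ψ x‖) '' Ω) →
      BddAbove ((fun x => ‖gradient ψ x‖) '' Ω) → 0 < L →
    ∀ V : Submodule ℝ (E n), Module.finrank ℝ V = d →
    ∀ ℓ : ℝ, 0 < ℓ → ℓ ≤ δ / 2 →
    ((n < 2 * d →
      min (δ * L)
          ((ℓ ^ (2 * d) / (C * lam ^ 2 * L ^ (2 * n - 2 * d))) ^ (1 / (2 * (d : ℝ) - n))) ≤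
        sSup (ψ '' (closedBall x₀ ℓ ∩ ((fun v => x₀ + v) '' (V : Set (E n)))))) ∧
     (2 * d = n →
      δ * L * Real.exp (-(C * lam ^ 2 * L ^ n / ℓ ^ n)) ≤
        sSup (ψ '' (closedBall x₀ ℓ ∩ ((fun v => x₀ + v) '' (V : Set (E n))))))) := by
  intro n _
  refine ⟨16 ^ n, by positivity, ?_⟩
  intro d hd1 hdn _ Ω hΩ ψ hψ hconv hnn lam hlam hdet x₀ hx₀ hψ0 δ hδ hδ0 L hLdef hLb hL0 V hV ℓ hℓ hℓδ
  obtain ⟨m, hnm⟩ : ∃ m, d + m = n := ⟨n - d, by omega⟩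
  obtain ⟨ι₁, ι₂, horth, hιV⟩ := exists_iso hnm V hV
  have hball := ball_subset_of_infDist x₀ hx₀ δ hδ hδ0
  have hL : ∀ x ∈ Ω, ‖fderiv ℝ ψ x‖ ≤ L := by
    intro x hx
    have h1 : ‖gradient ψ x‖ ≤ L := by
      rw [hLdef]; exact le_csSup hLb (mem_image_of_mem _ hx)
    rwa [gradient, LinearIsometryEquiv.norm_map] at h1
  set S := closedBall x₀ ℓ ∩ ((fun v => x₀ + v) '' (V : Set (E n))) with hS
  set T := sSup (ψ '' S) with hT
  have hbdd : BddAbove (ψ '' S) := by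
    have hsub : closedBall x₀ ℓ ⊆ Ω := (closedBall_subset_ball (by linarith)).trans hball
    exact ((isCompact_closedBall x₀ ℓ).bddAbove_image (hψ.continuousOn.mono hsub)).mono
      (image_mono inter_subset_left)
  have hle : ∀ x : E d, ‖x‖ ≤ ℓ → ψ (x₀ + ι₁ x) ≤ T := by
    intro x hx
    refine le_csSup hbdd (mem_image_of_mem _ ⟨?_, ι₁ x, hιV x, rfl⟩)
    simpa using hx
  have hT0 : 0 ≤ T := by
    have := hle 0 (by simpa using hℓ.le)
    rw [map_zero, add_zero, hψ0] at this
    exact this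
  have hkey : ∀ h, 0 < h → T ≤ h → ∀ r, r ≤ δ / 2 →
      ∫⁻ y in ball (0 : E m) r, ENNReal.ofReal (((h + L * ‖y‖) ^ d)⁻¹) ≤
      ENNReal.ofReal ((lam ^ 2 * ((2 / ℓ) ^ d) ^ 2 * L ^ m) * volume.real (ball (0 : E m) 1)) := by
    intro h hh hTh r hr
    rw [mul_assoc (lam ^ 2 * ((2 / ℓ) ^ d) ^ 2)]
    exact key hnm ι₁ ι₂ horth hΩ hψ hconv hnn lam hlam hdet x₀ δ hball L hL0 hL ℓ hℓ hℓδ r hr h hh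
      fun x hx => (hle x hx).trans hTh
  constructor
  · intro hlt
    refine le_of_forall_gt_imp_ge_of_dense fun h hTh => ?_
    have hh : 0 < h := lt_of_le_of_lt hT0 hTh
    rcases le_or_gt (δ * L) h with hc | hc
    · exact (min_le_left _ _).trans hc
    refine (min_le_right _ _).trans ?_
    refine alg1 hnm (by omega) lam L ℓ h hlam hL0 hℓ hh ?_
    refine lower_ball h L _ _ hh hL0 (by positivity) (by positivity) (hkey h hh hTh.le _ ?_)
    rw [div_le_iff₀ (by positivity)]
    linarith
  · intro heq
    obtain rfl : m = d := by omega
    rcases le_or_gt (δ * L) T with hc | hc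
    · refine le_trans ?_ hc
      refine mul_le_of_le_one_right (by positivity) (Real.exp_le_one_iff.mpr ?_)
      rw [neg_nonpos]; positivity
    refine le_of_forall_gt_imp_ge_of_dense fun h hTh => ?_
    have hh : 0 < h := lt_of_le_of_lt hT0 hTh
    refine alg2 heq hd1 lam L ℓ h δ hlam hL0 hℓ hh hδ0 ?_ fun hr => ?_
    · exact lower_ball _ L _ _ (by positivity) hL0 (by positivity) (by positivity)
        (hkey (δ * L) (by positivity) hc.le _ le_rfl)
    · exact lower_log hd1 h L _ _ hh hL0 hr (by positivity) (hkey h hh hTh.le _ le_rfl)
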